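/- arXiv:2112.01453 — 2 statements merged into one kernel-verified Lean document; each statement's English description precedes it below -/
import Mathlib

section
/- Let f : ℝ^d → ℝ be differentiable with L-Lipschitz gradient (L > 0) and bounded below, with infimum f* = inf_{x∈ℝ^d} f(x) > −∞. Let 0 < γ ≤ 1/(2L), and consider iterates x_{k+1} = x_k − γ·ĝ_k where ‖ĝ_k − ∇f(x_k)‖₂ ≤ ε_k for each k ≥ 0. Then for every k ≥ 1, min_{0 ≤ i ≤ k−1} ‖∇f(x_i)‖₂² ≤ (16/11)·(f(x_0) − f*)/(γk) + (32/11)·(1/k)·Σ_{i=0}^{k−1} ε_i². -/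
theorem descent_aux {E : Type*} [NormedAddCommGroup E] [InnerProductSpace ℝ E] [CompleteSpace E]
    (f : E → ℝ) (L : ℝ) (hf : Differentiable ℝ f)
    (hlip : ∀ x y, ‖gradient f x - gradient f y‖ ≤ L * ‖x - y‖) (x v : E) :
    f (x + v) ≤ f x + inner ℝ (gradient f x) v + L / 2 * ‖v‖ ^ 2 := by
  have hd : ∀ t : ℝ, HasDerivAt
      (fun t : ℝ => f (x + t • v) - t * inner ℝ (gradient f x) v - L / 2 * ‖v‖ ^ 2 * t ^ 2)
      (inner ℝ (gradient f (x + t • v)) v - inner ℝ (gradient f x) v - L * ‖v‖ ^ 2 * t) t := by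
    intro t
    have h1 : HasDerivAt (fun t : ℝ => x + t • v) v t := by
      simpa using ((hasDerivAt_id t).smul_const v).const_add x
    have h2 := (hf (x + t • v)).hasGradientAt.hasFDerivAt.comp_hasDerivAt t h1
    have h3 := (h2.sub ((hasDerivAt_id t).mul_const (inner ℝ (gradient f x) v))).sub
      (((hasDerivAt_id t).pow 2).const_mul (L / 2 * ‖v‖ ^ 2))
    refine h3.congr_deriv ?_
    simp
    ring
  have hanti := antitoneOn_of_deriv_nonpos (convex_Icc (0 : ℝ) 1)
    (fun t _ => (hd t).continuousAt.continuousWithinAt)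
    (fun t _ => (hd t).differentiableAt.differentiableWithinAt)
    (fun t ht => by
      rw [interior_Icc] at ht
      rw [(hd t).deriv, ← inner_sub_left]
      have h1 := real_inner_le_norm (gradient f (x + t • v) - gradient f x) v
      have h2 := hlip (x + t • v) x
      rw [add_sub_cancel_left, norm_smul, Real.norm_of_nonneg ht.1.le] at h2
      nlinarith [mul_le_mul_of_nonneg_right h2 (norm_nonneg v)])
  have h := hanti (Set.left_mem_Icc.2 zero_le_one) (Set.right_mem_Icc.2 zero_le_one) zero_le_one
  simp only [one_smul, zero_smul, add_zero, one_mul, zero_mul, one_pow, mul_one, sub_zero,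
    ne_eq, OfNat.ofNat_ne_zero, not_false_eq_true, zero_pow, mul_zero] at h
  linarith

/-- Approximate gradient descent on an `L`-smooth function `f` bounded below with infimum `f*`:
with step-size `0 < γ ≤ 1/(2L)` and iterates `x_{k+1} = x_k - γ ĝ_k` where
`‖ĝ_k - ∇f(x_k)‖ ≤ ε_k`, for every `k ≥ 1`,
`min_{0 ≤ i < k} ‖∇f(x_i)‖² ≤ (16/11)(f(x_0) - f*)/(γ k) + (32/11)(1/k) Σ_{i<k} ε_i²`. -/
theorem approx_gradient_descent_min_grad_le (d : ℕ) (f : EuclideanSpace ℝ (Fin d) → ℝ)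
    (L : ℝ) (hL : 0 < L) (hf : Differentiable ℝ f)
    (hlip : ∀ x y, ‖gradient f x - gradient f y‖ ≤ L * ‖x - y‖)
    (hbdd : BddBelow (Set.range f))
    (fstar : ℝ) (hfstar : fstar = ⨅ x, f x)
    (γ : ℝ) (hγ0 : 0 < γ) (hγ : γ ≤ 1 / (2 * L))
    (x ghat : ℕ → EuclideanSpace ℝ (Fin d)) (ε : ℕ → ℝ)
    (hgerr : ∀ k, ‖ghat k - gradient f (x k)‖ ≤ ε k)
    (hiter : ∀ k, x (k + 1) = x k - γ • ghat k)
    (k : ℕ) (hk : 1 ≤ k) :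
    (Finset.range k).inf' (Finset.nonempty_range_iff.mpr (Nat.one_le_iff_ne_zero.mp hk))
        (fun i => ‖gradient f (x i)‖ ^ 2) ≤
      (16 / 11) * (f (x 0) - fstar) / (γ * k) +
        (32 / 11) * (1 / (k : ℝ)) * ∑ i ∈ Finset.range k, ε i ^ 2 := by
  have hstep : ∀ i, 11 / 16 * γ * ‖gradient f (x i)‖ ^ 2 ≤
      f (x i) - f (x (i + 1)) + 2 * γ * ε i ^ 2 := by
    intro i
    have h := descent_aux f L hf hlip (x i) (-(γ • ghat i))
    rw [← sub_eq_add_neg, ← hiter, norm_neg, norm_smul, inner_neg_right, inner_smul_right,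
      Real.norm_of_nonneg hγ0.le] at h
    obtain ⟨e, he⟩ : ∃ e, e = ghat i - gradient f (x i) := ⟨_, rfl⟩
    have hg : ghat i = gradient f (x i) + e := by rw [he]; abel
    have hee := hgerr i
    rw [← he] at hee
    have he2 : ‖e‖ ^ 2 ≤ ε i ^ 2 := pow_le_pow_left₀ (norm_nonneg _) hee 2
    have hLγ : L * γ ≤ 1 / 2 := by
      rw [le_div_iff₀ (by positivity)] at hγ
      linarith
    have hq : L / 2 * (γ * ‖ghat i‖) ^ 2 ≤ γ * (1 / 4 * ‖ghat i‖ ^ 2) := by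
      have := mul_le_mul_of_nonneg_right hLγ (by positivity : 0 ≤ γ * ‖ghat i‖ ^ 2 / 2)
      nlinarith
    have hn : ‖ghat i‖ ^ 2 = ‖gradient f (x i)‖ ^ 2
        + 2 * inner ℝ (gradient f (x i)) e + ‖e‖ ^ 2 := by
      rw [hg, norm_add_sq_real]
    have hi : inner ℝ (gradient f (x i)) (ghat i) = ‖gradient f (x i)‖ ^ 2
        + inner ℝ (gradient f (x i)) e := by
      rw [hg, inner_add_right, real_inner_self_eq_norm_sq]
    have hc := (abs_le.1 (abs_real_inner_le_norm (gradient f (x i)) e)).1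
    have hkey : 11 / 16 * ‖gradient f (x i)‖ ^ 2 ≤ inner ℝ (gradient f (x i)) (ghat i)
        - 1 / 4 * ‖ghat i‖ ^ 2 + 2 * ε i ^ 2 := by
      rw [hi, hn]
      nlinarith [sq_nonneg (‖gradient f (x i)‖ - 4 * ‖e‖), sq_nonneg ‖e‖]
    have := mul_le_mul_of_nonneg_left hkey hγ0.le
    linarith
  have hsum := Finset.sum_le_sum (fun i (_ : i ∈ Finset.range k) => hstep i)
  rw [Finset.sum_add_distrib, Finset.sum_range_sub', ← Finset.mul_sum, ← Finset.mul_sum] at hsum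
  have hfk : fstar ≤ f (x k) := hfstar ▸ ciInf_le hbdd (x k)
  set m := (Finset.range k).inf' (Finset.nonempty_range_iff.mpr (Nat.one_le_iff_ne_zero.mp hk))
        (fun i => ‖gradient f (x i)‖ ^ 2) with hm
  have hmin : (k : ℝ) * m ≤ ∑ i ∈ Finset.range k, ‖gradient f (x i)‖ ^ 2 := by
    have := Finset.card_nsmul_le_sum (Finset.range k) (fun i => ‖gradient f (x i)‖ ^ 2) m
      (fun i hi => Finset.inf'_le _ hi)
    simpa using this
  have hk0 : (0 : ℝ) < k := by exact_mod_cast hk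
  have h1 := mul_le_mul_of_nonneg_left hmin (by positivity : 0 ≤ 11 / 16 * γ)
  have hrw : (16 / 11) * (f (x 0) - fstar) / (γ * k) +
        (32 / 11) * (1 / (k : ℝ)) * ∑ i ∈ Finset.range k, ε i ^ 2 =
      (16 / 11 * (f (x 0) - fstar) + 32 / 11 * γ * ∑ i ∈ Finset.range k, ε i ^ 2) / (γ * k) := by
    field_simp
  rw [hrw, le_div_iff₀ (by positivity)]
  linarith
end

section
/- Let 1 ≤ t ≤ L, and for s = t, …, L−1 let ψ_s : ℝ^p → ℝ^p be ℓ-Lipschitz and differentiable with M-Lipschitz Fréchet derivative. Let x_L, v_L ∈ ℝ^p and define backward recursively x_s = ψ_s(x_{s+1}) and v_s = ψ_s(v_{s+1}) for s = L−1, …, t. Let Δ = ‖v_L − x_L‖₂ and define ξ_s = v_s − x_s − Dψ_s(x_{s+1}) ∘ Dψ_{s+1}(x_{s+2}) ∘ … ∘ Dψ_{L−1}(x_L) (v_L − x_L). Then ‖ξ_s‖₂ ≤ a_s for all s, where a_L = 0 and a_s = ℓ·a_{s+1} + (M/2)·(ℓ^{L−1−s}·Δ)² for s = L−1, …, t. 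-/
lemma taylor_bound_aux {E : Type*} [NormedAddCommGroup E] [NormedSpace ℝ E]
    (f : E → E) (M : ℝ) (hd : Differentiable ℝ f)
    (hs : ∀ u w, ‖fderiv ℝ f u - fderiv ℝ f w‖ ≤ M * ‖u - w‖) (u w : E) :
    ‖f u - f w - fderiv ℝ f w (u - w)‖ ≤ M / 2 * ‖u - w‖ ^ 2 := by
  have hg : ∀ τ : ℝ, HasDerivAt (fun τ : ℝ => f (w + τ • (u - w)) - f w - τ • fderiv ℝ f w (u - w))
      (fderiv ℝ f (w + τ • (u - w)) (u - w) - fderiv ℝ f w (u - w)) τ := by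
    intro τ
    have h1 : HasDerivAt (fun τ : ℝ => w + τ • (u - w)) (u - w) τ := by
      simpa using ((hasDerivAt_id τ).smul_const (u - w)).const_add w
    have h2 := (hd (w + τ • (u - w))).hasFDerivAt.comp_hasDerivAt τ h1
    have h3 : HasDerivAt (fun τ : ℝ => τ • fderiv ℝ f w (u - w)) (fderiv ℝ f w (u - w)) τ := by
      simpa using (hasDerivAt_id τ).smul_const (fderiv ℝ f w (u - w))
    exact (h2.sub_const (f w)).sub h3
  have hB : ∀ τ : ℝ, HasDerivAt (fun τ : ℝ => M / 2 * ‖u - w‖ ^ 2 * τ ^ 2)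
      (M * ‖u - w‖ ^ 2 * τ) τ := by
    intro τ
    refine ((hasDerivAt_pow 2 τ).const_mul (M / 2 * ‖u - w‖ ^ 2)).congr_deriv ?_
    norm_num
    ring
  have key := image_norm_le_of_norm_deriv_right_le_deriv_boundary (a := (0 : ℝ)) (b := 1)
    (fun τ _ => (hg τ).continuousAt.continuousWithinAt)
    (fun τ _ => (hg τ).hasDerivWithinAt) (by simp) hB
    (by
      intro τ hτ
      rw [← sub_apply]
      refine (ContinuousLinearMap.le_opNorm _ _).trans ?_
      have h := hs (w + τ • (u - w)) w
      rw [add_sub_cancel_left, norm_smul, Real.norm_of_nonneg hτ.1] at h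
      calc _ ≤ M * (τ * ‖u - w‖) * ‖u - w‖ := by gcongr
        _ = _ := by ring) (x := 1) (by simp)
  simpa using key

/-- Propagation of the linearization error in difference target propagation: for
`c`-Lipschitz maps `ψ_s` with `M`-Lipschitz Fréchet derivatives, backward iterates
`x_s = ψ_s(x_{s+1})`, `v_s = ψ_s(v_{s+1})` for `t ≤ s < L`, and the errors
`ξ_s = v_s - x_s - (Dψ_s(x_{s+1}) ∘ … ∘ Dψ_{L-1}(x_L))(v_L - x_L)`, one has `‖ξ_s‖ ≤ a_s`
where `a_L = 0` and `a_s = c a_{s+1} + (M/2)(c^{L-1-s} ‖v_L - x_L‖)²`.  The composition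
of Jacobians is encoded as the product of the list `[Dψ_s(x_{s+1}), …, Dψ_{L-1}(x_L)]`. -/
theorem dtp_linearization_error (p t L : ℕ) (ht1 : 1 ≤ t) (htL : t ≤ L)
    (ψ : ℕ → EuclideanSpace ℝ (Fin p) → EuclideanSpace ℝ (Fin p)) (c M : ℝ)
    (hlip : ∀ s, t ≤ s → s < L → ∀ u w, ‖ψ s u - ψ s w‖ ≤ c * ‖u - w‖)
    (hdiff : ∀ s, t ≤ s → s < L → Differentiable ℝ (ψ s))
    (hsmooth : ∀ s, t ≤ s → s < L →
      ∀ u w, ‖fderiv ℝ (ψ s) u - fderiv ℝ (ψ s) w‖ ≤ M * ‖u - w‖)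
    (x v : ℕ → EuclideanSpace ℝ (Fin p))
    (hx : ∀ s, t ≤ s → s < L → x s = ψ s (x (s + 1)))
    (hv : ∀ s, t ≤ s → s < L → v s = ψ s (v (s + 1)))
    (a : ℕ → ℝ) (haL : a L = 0)
    (ha : ∀ s, t ≤ s → s < L →
      a s = c * a (s + 1) + (M / 2) * (c ^ (L - 1 - s) * ‖v L - x L‖) ^ 2) :
    ∀ s, t ≤ s → s ≤ L →
      ‖v s - x s -
          (((List.range (L - s)).map
              (fun i => fderiv ℝ (ψ (s + i)) (x (s + i + 1)))).prod) (v L - x L)‖ ≤ a s := by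
  have main : ∀ n s, t ≤ s → s + n = L → ‖v s - x s‖ ≤ c ^ n * ‖v L - x L‖ ∧
      ‖v s - x s - (((List.range n).map
        (fun i => fderiv ℝ (ψ (s + i)) (x (s + i + 1)))).prod) (v L - x L)‖ ≤ a s := by
    intro n
    induction n with
    | zero =>
      intro s _ h
      obtain rfl : s = L := by omega
      simp [haL]
    | succ n ih =>
      intro s hts hsL
      have hlt : s < L := by omega
      obtain ⟨ih1, ih2⟩ := ih (s + 1) (by omega) (by omega)
      have e : L - 1 - s = n := by omega
      have has := ha s hts hlt
      rw [e] at has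
      rcases subsingleton_or_nontrivial (EuclideanSpace ℝ (Fin p)) with hE | hE
      · have hz : ∀ y : EuclideanSpace ℝ (Fin p), ‖y‖ = 0 := fun y => by
          rw [Subsingleton.elim y 0, norm_zero]
        have hall : ∀ m r, t ≤ r → r + m = L → a r = 0 := by
          intro m
          induction m with
          | zero => intro r _ h; obtain rfl : r = L := by omega
                    exact haL
          | succ m ihm =>
            intro r hr h
            rw [ha r hr (by omega), ihm (r + 1) (by omega) (by omega), hz]
            simp
        rw [hall _ s hts hsL, hz, hz, hz]
        simp
      · obtain ⟨y, hy⟩ := exists_ne (0 : EuclideanSpace ℝ (Fin p))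
        have hy' : 0 < ‖y‖ := norm_pos_iff.2 hy
        have hc : 0 ≤ c := by
          have h := (norm_nonneg _).trans (hlip s hts hlt y 0)
          rw [sub_zero] at h
          exact nonneg_of_mul_nonneg_left h hy'
        have hM : 0 ≤ M := by
          have h := (norm_nonneg _).trans (hsmooth s hts hlt y 0)
          rw [sub_zero] at h
          exact nonneg_of_mul_nonneg_left h hy'
        have hD : ‖fderiv ℝ (ψ s) (x (s + 1))‖ ≤ c :=
          norm_fderiv_le_of_lip' ℝ hc (Filter.Eventually.of_forall fun z => hlip s hts hlt z _)
        have hT := taylor_bound_aux (ψ s) M (hdiff s hts hlt) (hsmooth s hts hlt)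
          (v (s + 1)) (x (s + 1))
        rw [← hv s hts hlt, ← hx s hts hlt] at hT
        constructor
        · have h := hlip s hts hlt (v (s + 1)) (x (s + 1))
          rw [← hv s hts hlt, ← hx s hts hlt] at h
          calc _ ≤ _ := h
            _ ≤ c * (c ^ n * ‖v L - x L‖) := by gcongr
            _ = _ := by ring
        · have hl : ((List.range (n + 1)).map
              (fun i => fderiv ℝ (ψ (s + i)) (x (s + i + 1)))).prod =
              fderiv ℝ (ψ s) (x (s + 1)) * ((List.range n).map
              (fun i => fderiv ℝ (ψ (s + 1 + i)) (x (s + 1 + i + 1)))).prod := by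
            rw [List.range_succ_eq_map, List.map_cons, List.prod_cons, List.map_map]
            congr 3
            funext i
            simp only [Function.comp]
            rw [show s + i.succ = s + 1 + i by omega]
          rw [hl, has, ContinuousLinearMap.mul_def, ContinuousLinearMap.comp_apply]
          generalize ((List.range n).map
              (fun i => fderiv ℝ (ψ (s + 1 + i)) (x (s + 1 + i + 1)))).prod (v L - x L) = q at *
          have hq : v s - x s - fderiv ℝ (ψ s) (x (s + 1)) q =
              fderiv ℝ (ψ s) (x (s + 1)) (v (s + 1) - x (s + 1) - q) +
              (v s - x s - fderiv ℝ (ψ s) (x (s + 1)) (v (s + 1) - x (s + 1))) := by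
            rw [map_sub _ _ q]; abel
          rw [hq]
          refine (norm_add_le _ _).trans (add_le_add ?_ (hT.trans ?_))
          · refine (ContinuousLinearMap.le_opNorm _ _).trans ?_
            gcongr
          · gcongr
  intro s hts hsL
  exact (main (L - s) s hts (by omega)).2
end
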